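/- arXiv:2302.00997 — 5 statements merged into one kernel-verified Lean document; each statement's English description precedes it below -/
import Mathlib

section
/- Let T, m ∈ ℕ with T ≥ 1 and m ≥ 1, let τ ∈ ℕ with 1 ≤ τ ≤ T, let β : Fin m → ℝ with β_i > 0 for all i, set μ = T, and let R₁, R₂, V ∈ ℝ with V ≥ −1. For each t ∈ {1,…,τ} let p_t, f_t ∈ ℝ, g_t : Fin m → ℝ, and i_t ∈ Fin m, and define a_t = p_t − μ/T + f_t + μ·g_t(i_t)/(T·β_{i_t}). Assume: (i) Σ_{t=1}^τ a_t ≤ τ·V + R₁; (ii) for every i ∈ Fin m, Σ_{t=1}^τ a_t ≥ Σ_{t=1}^τ [p_t − μ/T + f_t + μ·g_t(i)/(T·β_i)] − R₂; (iii) there exists i' ∈ Fin m with Σ_{t=1}^τ g_t(i') ≥ T·β_{i'}. Then Σ_{t=1}^τ (p_t + f_t) ≤ T·V + R₁ + R₂. -/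
/-- Deterministic core of the regret bound of the DAL algorithm (Theorem 1). -/
theorem stmt2 (T m : ℕ) (hT : 1 ≤ T) (hm : 1 ≤ m)
    (τ : ℕ) (hτ1 : 1 ≤ τ) (hτT : τ ≤ T)
    (beta : Fin m → ℝ) (hbeta : ∀ i, 0 < beta i)
    (μ R1 R2 V : ℝ) (hμ : μ = T) (hV : -1 ≤ V)
    (p f : Fin τ → ℝ) (g : Fin τ → Fin m → ℝ) (idx : Fin τ → Fin m)
    (a : Fin τ → ℝ)
    (ha : ∀ t, a t = p t - μ / T + f t + μ * g t (idx t) / (T * beta (idx t)))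
    (h1 : ∑ t, a t ≤ τ * V + R1)
    (h2 : ∀ i, ∑ t, a t ≥ ∑ t, (p t - μ / T + f t + μ * g t i / (T * beta i)) - R2)
    (h3 : ∃ i', ∑ t, g t i' ≥ T * beta i') :
    ∑ t, (p t + f t) ≤ T * V + R1 + R2 := by
  obtain ⟨i, hi⟩ := h3
  have hT0 : (T : ℝ) ≠ 0 := by positivity
  have hτT' : (τ : ℝ) ≤ T := by exact_mod_cast hτT
  have hsum : ∑ t, (p t - μ / T + f t + μ * g t i / (T * beta i))
      = ∑ t, (p t + f t) - τ + (∑ t, g t i) / beta i := by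
    have hterm : ∀ t, p t - μ / T + f t + μ * g t i / (T * beta i)
        = (p t + f t) - 1 + g t i / beta i := fun t => by
      rw [hμ, div_self hT0, mul_div_mul_left _ _ hT0]
      ring
    simp only [hterm, Finset.sum_add_distrib, Finset.sum_sub_distrib, Finset.sum_div]
    simp
  have hviol : (T : ℝ) ≤ (∑ t, g t i) / beta i := (le_div_iff₀ (hbeta i)).2 hi
  have hregret := h2 i
  rw [hsum] at hregret
  have hslack : 0 ≤ ((T : ℝ) - τ) * (V + 1) :=
    mul_nonneg (by linarith) (by linarith)
  linarith
end

section
/- Let C be a nonempty set, let m, T ∈ ℕ with T ≥ 1, and for each t ∈ {1,…,T} let G_t : C → (Fin m → ℝ) → ℝ be such that for each λ with λ ≥ 0 the functions c ↦ G_t(c,λ) are bounded below on C. Let λ* ∈ ℝ^m with λ*_i ≥ 0 for all i and let c*_t ∈ C for each t. Assume: (i) for each t, c*_t minimizes c ↦ G_t(c, λ*) over C; (ii) for each t, λ* maximizes λ ↦ G_t(c*_t, λ) over {λ ∈ ℝ^m : λ ≥ 0}. Then: (a) for each t, λ* maximizes λ ↦ inf_{c∈C} G_t(c,λ) over {λ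 ≥ 0}, and sup_{λ≥0} inf_{c∈C} G_t(c,λ) = G_t(c*_t, λ*); and (b) sup_{λ≥0} inf_{(c_1,…,c_T)∈C^T} Σ_{t=1}^T G_t(c_t, λ) = Σ_{t=1}^T sup_{λ≥0} inf_{c∈C} G_t(c,λ). -/
/-- At a minimizer, the infimum of a real function is the value there. -/
theorem ciInf_eq_of_forall_apply_le {D : Type*} {f : D → ℝ} {d : D}
    (h : ∀ x, f d ≤ f x) : ⨅ x, f x = f d :=
  IsLeast.csInf_eq ⟨⟨d, rfl⟩, Set.forall_mem_range.2 h⟩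

/-- The max-min value of a real function with a saddle point is its value at the saddle point. -/
theorem ciSup_ciInf_eq_of_saddle {D L : Type*} {F : D → L → ℝ}
    (hbdd : ∀ l, BddBelow (Set.range fun d => F d l)) {d : D} {l : L}
    (hmin : ∀ x, F d l ≤ F x l) (hmax : ∀ y, F d y ≤ F d l) :
    ⨆ y, ⨅ x, F x y = F d l :=
  IsGreatest.csSup_eq ⟨⟨l, ciInf_eq_of_forall_apply_le hmin⟩,
    Set.forall_mem_range.2 fun y => (ciInf_le (hbdd y) d).trans (hmax y)⟩

/-- Lemma 4 in abstract form: a common saddle point for every per-period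
Lagrangian decomposes the aggregate dual problem. -/
theorem stmt5 {C : Type*} [Nonempty C] (m T : ℕ) (hT : 1 ≤ T)
    (G : Fin T → C → (Fin m → ℝ) → ℝ)
    (hbdd : ∀ t, ∀ lam : Fin m → ℝ, 0 ≤ lam →
      BddBelow (Set.range fun c => G t c lam))
    (lamStar : Fin m → ℝ) (hlam : 0 ≤ lamStar)
    (cStar : Fin T → C)
    (hmin : ∀ t, ∀ c : C, G t (cStar t) lamStar ≤ G t c lamStar)
    (hmaxpt : ∀ t, ∀ lam : Fin m → ℝ, 0 ≤ lam →
      G t (cStar t) lam ≤ G t (cStar t) lamStar) :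
    (∀ t, (∀ lam : Fin m → ℝ, 0 ≤ lam →
        (⨅ c : C, G t c lam) ≤ ⨅ c : C, G t c lamStar) ∧
      (⨆ lam : {l : Fin m → ℝ // 0 ≤ l}, ⨅ c : C, G t c lam.1)
        = G t (cStar t) lamStar)
    ∧ (⨆ lam : {l : Fin m → ℝ // 0 ≤ l},
          ⨅ cs : Fin T → C, ∑ t, G t (cs t) lam.1)
        = ∑ t, ⨆ lam : {l : Fin m → ℝ // 0 ≤ l}, ⨅ c : C, G t c lam.1 := by
  have hval : ∀ t, (⨆ lam : {l : Fin m → ℝ // 0 ≤ l}, ⨅ c : C, G t c lam.1)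
      = G t (cStar t) lamStar := fun t =>
    ciSup_ciInf_eq_of_saddle (F := fun c (lam : {l : Fin m → ℝ // 0 ≤ l}) => G t c lam.1)
      (l := ⟨lamStar, hlam⟩) (fun lam => hbdd t lam.1 lam.2) (hmin t)
      (fun lam => hmaxpt t lam.1 lam.2)
  refine ⟨fun t => ⟨fun lam hl => ?_, hval t⟩, ?_⟩
  · rw [ciInf_eq_of_forall_apply_le (f := fun c => G t c lamStar) (hmin t)]
    exact (ciInf_le (hbdd t lam hl) (cStar t)).trans (hmaxpt t lam hl)
  · simp only [hval]
    refine ciSup_ciInf_eq_of_saddle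
      (F := fun (cs : Fin T → C) (lam : {l : Fin m → ℝ // 0 ≤ l}) => ∑ t, G t (cs t) lam.1)
      (l := ⟨lamStar, hlam⟩) (fun lam => ?_)
      (fun cs => Finset.sum_le_sum fun t _ => hmin t (cs t))
      (fun lam => Finset.sum_le_sum fun t _ => hmaxpt t lam.1 lam.2)
    refine ⟨∑ t, ⨅ c, G t c lam.1, Set.forall_mem_range.2 fun cs => ?_⟩
    exact Finset.sum_le_sum fun t _ => ciInf_le (hbdd t lam.1 lam.2) (cs t)
end

section
/- Let n ∈ ℕ and let C ⊆ ℝ^n (Euclidean space with the standard inner product) be a nonempty closed convex set of diameter at most F, i.e., ‖y − y'‖ ≤ F for all y, y' ∈ C. Let T ≥ 1, let h_1,…,h_T : ℝ^n → ℝ, and for each t ∈ {1,…,T} let c_t ∈ C and g_t ∈ ℝ^n satisfy: (i) g_t is a subgradient of h_t at c_t relative to C, i.e., h_t(y) ≥ h_t(c_t) + ⟨g_t, y − c_t⟩ for all y ∈ C, and ‖g_t‖ ≤ G; (ii) c_1 ∈ C and, for 1 ≤ t < T, c_{t+1} ∈ C is a nearest point of C to c_t − η_t·g_t with step size η_t =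 1/√t, i.e., ‖c_{t+1} − (c_t − η_t g_t)‖ ≤ ‖y − (c_t − η_t g_t)‖ for all y ∈ C. Then for every c ∈ C, Σ_{t=1}^T h_t(c_t) − Σ_{t=1}^T h_t(c) ≤ (F²/2 + G²)·√T. -/
open RealInnerProductSpace

/-- A nearest point `p` of a convex set to `u` is at least as close to every point of the set as
`u` is. -/
theorem norm_sub_le_of_forall_norm_sub_le {E : Type*} [NormedAddCommGroup E]
    [InnerProductSpace ℝ E] {K : Set E} (hK : Convex ℝ K) {u p y : E} (hp : p ∈ K)
    (hmin : ∀ w ∈ K, ‖p - u‖ ≤ ‖w - u‖) (hy : y ∈ K) : ‖p - y‖ ≤ ‖u - y‖ := by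
  have : Nonempty K := ⟨⟨p, hp⟩⟩
  have hinf : ‖u - p‖ = ⨅ w : K, ‖u - w‖ := by
    refine le_antisymm (le_ciInf fun w => ?_) (ciInf_le ⟨0, ?_⟩ (⟨p, hp⟩ : K))
    · simpa only [norm_sub_rev] using hmin w w.2
    · rintro _ ⟨w, rfl⟩
      exact norm_nonneg _
  have hinner := (norm_eq_iInf_iff_real_inner_le_zero hK hp).1 hinf y hy
  have hexp := norm_sub_sq_real (u - p) (y - p)
  rw [sub_sub_sub_cancel_right, norm_sub_rev y p] at hexp
  refine (sq_le_sq₀ (norm_nonneg _) (norm_nonneg _)).1 ?_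
  linarith [sq_nonneg ‖u - p‖]

/-- If the gradient step `x - s⁻¹ • g` is at distance at least `D` from `y`, then the linearized
loss of `x` against `y` is controlled by the decrease of the squared distance to `y`. -/
theorem inner_sub_le_of_le_norm_step {E : Type*} [NormedAddCommGroup E]
    [InnerProductSpace ℝ E] {x y g : E} {s D G : ℝ} (hs : 0 < s) (hD : 0 ≤ D)
    (hg : ‖g‖ ≤ G) (hstep : D ≤ ‖x - (1 / s) • g - y‖) :
    ⟪g, x - y⟫ ≤ s / 2 * (‖x - y‖ ^ 2 - D ^ 2) + G ^ 2 * (1 / (2 * s)) := by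
  have hsq : D ^ 2 ≤ ‖x - (1 / s) • g - y‖ ^ 2 := by gcongr
  have hgsq : ‖g‖ ^ 2 ≤ G ^ 2 := by gcongr
  rw [sub_right_comm, norm_sub_sq_real, real_inner_smul_right, real_inner_comm, norm_smul,
    mul_pow, Real.norm_eq_abs, sq_abs] at hsq
  calc ⟪g, x - y⟫
      = s / 2 * (‖x - y‖ ^ 2 - (‖x - y‖ ^ 2 - 2 * (1 / s * ⟪g, x - y⟫) +
          (1 / s) ^ 2 * ‖g‖ ^ 2)) + ‖g‖ ^ 2 * (1 / (2 * s)) := by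
        field_simp
        ring
    _ ≤ s / 2 * (‖x - y‖ ^ 2 - D ^ 2) + G ^ 2 * (1 / (2 * s)) := by gcongr

/-- One step of the telescoping argument for the potential `√k / 2 * D ^ 2`. -/
theorem add_le_of_potential_step {k : ℕ} {S x F G D D' : ℝ} (hD : 0 ≤ D) (hDF : D ≤ F)
    (hS : S ≤ (F ^ 2 / 2 + G ^ 2) * √k - √k / 2 * D ^ 2)
    (hx : x ≤ √(k + 1 : ℕ) / 2 * (D ^ 2 - D' ^ 2) + G ^ 2 * (1 / (2 * √(k + 1 : ℕ)))) :
    S + x ≤ (F ^ 2 / 2 + G ^ 2) * √(k + 1 : ℕ) - √(k + 1 : ℕ) / 2 * D' ^ 2 := by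
  have hpos : 0 < √((k + 1 : ℕ) : ℝ) := Real.sqrt_pos.2 (by positivity)
  have hle : √(k : ℝ) ≤ √((k + 1 : ℕ) : ℝ) := Real.sqrt_le_sqrt (by simp)
  have hk : √(k : ℝ) ^ 2 = k := Real.sq_sqrt (by positivity)
  have hk' : √((k + 1 : ℕ) : ℝ) ^ 2 = k + 1 := by
    rw [Real.sq_sqrt (by positivity)]
    push_cast
    rfl
  have hinv : 1 / (2 * √((k + 1 : ℕ) : ℝ)) ≤ √((k + 1 : ℕ) : ℝ) - √(k : ℝ) := by
    rw [div_le_iff₀ (by positivity)]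
    nlinarith
  have hDsq : D ^ 2 ≤ F ^ 2 := by gcongr
  nlinarith [mul_le_mul_of_nonneg_left hinv (sq_nonneg G),
    mul_le_mul_of_nonneg_left hDsq (sub_nonneg.2 hle)]

/-- Regret bound of Online Gradient Descent with step sizes `η_t = 1/√t`
(Theorem B.1). -/
theorem stmt6 {n : ℕ} (C : Set (EuclideanSpace ℝ (Fin n)))
    (hCne : C.Nonempty) (hCclosed : IsClosed C) (hCconv : Convex ℝ C)
    (F : ℝ) (hF : ∀ y ∈ C, ∀ y' ∈ C, ‖y - y'‖ ≤ F)
    (T : ℕ) (hT : 1 ≤ T)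
    (h : ℕ → EuclideanSpace ℝ (Fin n) → ℝ)
    (c g : ℕ → EuclideanSpace ℝ (Fin n)) (G : ℝ)
    (hc : ∀ t, 1 ≤ t → t ≤ T → c t ∈ C)
    (hsub : ∀ t, 1 ≤ t → t ≤ T → ∀ y ∈ C,
      h t (c t) + ⟪g t, y - c t⟫ ≤ h t y)
    (hG : ∀ t, 1 ≤ t → t ≤ T → ‖g t‖ ≤ G)
    (hproj : ∀ t, 1 ≤ t → t < T → ∀ y ∈ C,
      ‖c (t + 1) - (c t - (1 / Real.sqrt t) • g t)‖
        ≤ ‖y - (c t - (1 / Real.sqrt t) • g t)‖) :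
    ∀ c0 ∈ C,
      (∑ t ∈ Finset.Icc 1 T, h t (c t)) - ∑ t ∈ Finset.Icc 1 T, h t c0
        ≤ (F ^ 2 / 2 + G ^ 2) * Real.sqrt T := by
  intro c0 hc0
  have hdist : ∀ t, 1 ≤ t → t ≤ T → ‖c t - c0‖ ≤ F := fun t h1 h2 =>
    hF _ (hc t h1 h2) _ hc0
  have hlin : ∀ t, 1 ≤ t → t ≤ T → h t (c t) - h t c0 ≤ ⟪g t, c t - c0⟫ := by
    intro t h1 h2
    have := hsub t h1 h2 c0 hc0
    rw [← neg_sub (c t) c0, inner_neg_right] at this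
    linarith
  have hspos : ∀ k : ℕ, 0 < √((k + 1 : ℕ) : ℝ) := fun k => Real.sqrt_pos.2 (by positivity)
  have hpot : ∀ k < T, ∑ t ∈ Finset.Icc 1 k, (h t (c t) - h t c0) ≤
      (F ^ 2 / 2 + G ^ 2) * √k - √k / 2 * ‖c (k + 1) - c0‖ ^ 2 := by
    intro k
    induction k with
    | zero => simp
    | succ k ih =>
      intro hk
      rw [Finset.sum_Icc_succ_top (by omega)]
      refine add_le_of_potential_step (norm_nonneg _) (hdist (k + 1) (by omega) hk.le)
        (ih (by omega)) ((hlin (k + 1) (by omega) hk.le).trans ?_)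
      exact inner_sub_le_of_le_norm_step (hspos k) (norm_nonneg _) (hG _ (by omega) hk.le)
        (norm_sub_le_of_forall_norm_sub_le hCconv (hc _ (by omega) hk)
          (hproj (k + 1) (by omega) hk) hc0)
  obtain ⟨k, rfl⟩ : ∃ k, T = k + 1 := ⟨T - 1, by omega⟩
  rw [← Finset.sum_sub_distrib, Finset.sum_Icc_succ_top (by omega)]
  have hlast := add_le_of_potential_step (norm_nonneg _) (hdist (k + 1) hT le_rfl)
    (hpot k k.lt_succ_self) ((hlin (k + 1) hT le_rfl).trans
      (inner_sub_le_of_le_norm_step (hspos k) le_rfl (hG _ hT le_rfl) (norm_nonneg _)))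
  simpa using hlast
end

section
/- Let T, m ∈ ℕ with T ≥ 1 and m ≥ 1, let β : Fin m → ℝ with 0 < β_i for all i and β_max = max_i β_i, let μ ≥ 0 and R₁, R₂, V ∈ ℝ. For each t ∈ {1,…,T} let p_t, f_t ∈ ℝ, g_t : Fin m → ℝ, and i_t ∈ Fin m, and define a_t = p_t + μ/T + f_t − μ·g_t(i_t)/(T·β_{i_t}). Let d = max_i (β_i − (1/T)·Σ_{t=1}^T g_t(i)) and assume d ≥ 0. Assume: (i) Σ_{t=1}^T a_t ≤ T·V + R₁; (ii) for every i ∈ Fin m, Σ_{t=1}^T a_t ≥ Σ_{t=1}^T [p_t + μ/T + f_t − μ·g_t(i)/(T·β_i)] − R₂. Then Σ_{t=1}^T (p_t + f_t) + (μ/β_max)·d ≤ T·V + R₁ + R₂. -/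
/-- Deterministic core of Theorem 8: regret and covering-constraint shortfall
bound of the DAL algorithm with covering constraints. -/
theorem stmt11 (T m : ℕ) (hT : 1 ≤ T) (hm : 1 ≤ m)
    (beta : Fin m → ℝ) (hbeta : ∀ i, 0 < beta i)
    (μ R1 R2 V : ℝ) (hμ : 0 ≤ μ)
    (p f : Fin T → ℝ) (g : Fin T → Fin m → ℝ) (idx : Fin T → Fin m)
    (a : Fin T → ℝ)
    (ha : ∀ t, a t = p t + μ / T + f t - μ * g t (idx t) / (T * beta (idx t)))
    (d : ℝ) (hd : d = ⨆ i : Fin m, (beta i - (1 / T) * ∑ t, g t i))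
    (hd0 : 0 ≤ d)
    (h1 : ∑ t, a t ≤ T * V + R1)
    (h2 : ∀ i, ∑ t, a t ≥ ∑ t, (p t + μ / T + f t - μ * g t i / (T * beta i)) - R2) :
    ∑ t, (p t + f t) + (μ / (⨆ i : Fin m, beta i)) * d ≤ T * V + R1 + R2 := by
  have : Nonempty (Fin m) := ⟨⟨0, hm⟩⟩
  have hT0 : (T : ℝ) ≠ 0 := by positivity
  obtain ⟨i, hi⟩ := exists_eq_ciSup_of_finite (f := fun i : Fin m => beta i - (1 / T) * ∑ t, g t i)
  have hdi : d = beta i - (1 / T) * ∑ t, g t i := hd.trans hi.symm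
  have hle : beta i ≤ ⨆ j, beta j := le_ciSup (Set.finite_range beta).bddAbove i
  have hbi : beta i ≠ 0 := (hbeta i).ne'
  have hsum : ∑ t, (p t + μ / T + f t - μ * g t i / (T * beta i))
      = ∑ t, (p t + f t) + μ / beta i * d := by
    simp only [Finset.sum_sub_distrib, Finset.sum_add_distrib, ← Finset.sum_div,
      ← Finset.mul_sum, Finset.sum_const, Finset.card_univ, Fintype.card_fin, nsmul_eq_mul, hdi]
    field_simp
    ring
  have hmul : μ / (⨆ j, beta j) * d ≤ μ / beta i * d :=
    mul_le_mul_of_nonneg_right (div_le_div_of_nonneg_left hμ (hbeta i) hle) hd0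
  have hi2 := h2 i
  rw [hsum] at hi2
  linarith
end

section
/- Let T, m ∈ ℕ with T ≥ 1 and m ≥ 1, let β : Fin m → ℝ with 0 < β_i ≤ 1 for all i, let μ ≥ 0 and R, U ∈ ℝ. For each t ∈ {1,…,T} let p_t, f_t ∈ ℝ, let g_t, β̂_t : Fin m → ℝ, let i_t ∈ Fin m, and define â_t = p_t − μ·β̂_t(i_t)/(T·β_{i_t}) + f_t + μ·g_t(i_t)/(T·β_{i_t}). Assume: (i) for every i ∈ Fin m, Σ_{t=1}^T â_t ≥ Σ_{t=1}^T [p_t − μ·β̂_t(i)/(T·β_i) + f_t + μ·g_t(i)/(T·β_i)] − R; (ii) for every i, Σ_{t=1}^T β̂_t(i) ≤ T·β_i; (iii) Σ_{t=1}^T â_t ≤ U. Let d = max_i ((1/T)·Σ_{t=1}^T g_t(i) − β_i) and assume d ≥ 0. Then Σ_{t=1}^T (p_t + f_t) + μ·d ≤ U + R. -/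
/-- Deterministic core of Theorem 5: regret and constraint-violation bound of
the Informative Adversarial Learning algorithm. -/
theorem stmt14 (T m : ℕ) (hT : 1 ≤ T) (hm : 1 ≤ m)
    (beta : Fin m → ℝ) (hbeta : ∀ i, 0 < beta i ∧ beta i ≤ 1)
    (μ R U : ℝ) (hμ : 0 ≤ μ)
    (p f : Fin T → ℝ) (g bhat : Fin T → Fin m → ℝ) (idx : Fin T → Fin m)
    (a : Fin T → ℝ)
    (ha : ∀ t, a t = p t - μ * bhat t (idx t) / (T * beta (idx t)) + f t
        + μ * g t (idx t) / (T * beta (idx t)))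
    (h1 : ∀ i, ∑ t, a t ≥ ∑ t, (p t - μ * bhat t i / (T * beta i) + f t
        + μ * g t i / (T * beta i)) - R)
    (h2 : ∀ i, ∑ t, bhat t i ≤ T * beta i)
    (h3 : ∑ t, a t ≤ U)
    (d : ℝ) (hd : d = ⨆ i : Fin m, ((1 / T) * ∑ t, g t i - beta i))
    (hd0 : 0 ≤ d) :
    ∑ t, (p t + f t) + μ * d ≤ U + R := by
  have : Nonempty (Fin m) := ⟨⟨0, hm⟩⟩
  obtain ⟨i, hi⟩ := exists_eq_ciSup_of_finite
    (f := fun i : Fin m => (1 / (T : ℝ)) * ∑ t, g t i - beta i)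
  rw [← hi] at hd
  obtain ⟨hb0, hb1⟩ := hbeta i
  have hT0 : (0 : ℝ) < T := by exact_mod_cast hT
  have hsum : ∑ t, (p t - μ * bhat t i / (T * beta i) + f t + μ * g t i / (T * beta i))
      = ∑ t, (p t + f t) + μ * ((∑ t, g t i - ∑ t, bhat t i) / (T * beta i)) := by
    rw [← Finset.sum_sub_distrib, Finset.sum_div, Finset.mul_sum, ← Finset.sum_add_distrib]
    exact Finset.sum_congr rfl fun t _ => by ring
  have hTd : T * d = ∑ t, g t i - T * beta i := by
    rw [hd]
    field_simp
  have hle : d ≤ (∑ t, g t i - ∑ t, bhat t i) / (T * beta i) := by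
    rw [le_div_iff₀ (by positivity)]
    have hshrink : T * d * beta i ≤ T * d := mul_le_of_le_one_right (by positivity) hb1
    linarith [h2 i]
  have hmul := mul_le_mul_of_nonneg_left hle hμ
  have hregret := h1 i
  rw [hsum] at hregret
  linarith
end
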